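/- arXiv:1312.1497 — 2 statements merged into one kernel-verified Lean document; each statement's English description precedes it below -/
import Mathlib

section
/- For every group-theoretical category of partitions C, F(C) = F(C_sl), i.e. every element of F(C) arises as w(p,l) for a partition p ∈ C in single leg form with no upper points and some labelling l. -/
open Classical

/-- A partition diagram with `upper` upper points and `lower` lower points; the blocks are
encoded by the equivalence relation (setoid) on the disjoint union of the points. -/
structure PartitionDiagram where
  upper : ℕ
  lower : ℕ
  rel : Setoid (Fin upper ⊕ Fin lower)

namespace PartitionDiagram

/-- The partition determined by a labelling of the points: two points lie in the same block
iff they receive the same label. -/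
def ofLabels {u l : ℕ} (f : Fin u ⊕ Fin l → ℕ) : PartitionDiagram :=
  ⟨u, l, Setoid.ker f⟩

/-- The identity partition `| ∈ P(1,1)`. -/
def idPartition : PartitionDiagram := ofLabels (u := 1) (l := 1) fun _ => 0

/-- The pair partition `⊓ ∈ P(0,2)`. -/
def pairPartition : PartitionDiagram := ofLabels (u := 0) (l := 2) fun _ => 0

/-- The four block partition `⊓⊓ ∈ P(0,4)`. -/
def fourBlock : PartitionDiagram := ofLabels (u := 0) (l := 4) fun _ => 0

/-- The singleton partition `↑ ∈ P(0,1)`. -/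
def singletonPartition : PartitionDiagram := ofLabels (u := 0) (l := 1) fun _ => 0

/-- The double singleton partition `↑⊗↑ ∈ P(0,2)`. -/
def doubleSingleton : PartitionDiagram :=
  ofLabels (u := 0) (l := 2) (Sum.elim (fun i => (i : ℕ)) fun j => (j : ℕ))

/-- The crossing partition `⨯ ∈ P(2,2)`, with blocks `{1,2'}` and `{2,1'}`. -/
def crossing : PartitionDiagram :=
  ofLabels (u := 2) (l := 2) (Sum.elim (fun i => (i : ℕ)) fun j => 1 - (j : ℕ))

/-- The pair positioner partition `▷ ∈ P(3,3)`, with blocks `{1,2,2',3'}` and `{3,1'}`. -/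
def pairPositioner : PartitionDiagram :=
  ofLabels (u := 3) (l := 3)
    (Sum.elim (fun i => if (i : ℕ) = 2 then 1 else 0) fun j => if (j : ℕ) = 0 then 1 else 0)

/-- The partition `k_l ∈ P(l+2, l+2)` consisting of the four block `{1, 1', l+2, (l+2)'}`
together with the pairs `{j, j'}` for `2 ≤ j ≤ l+1`. -/
def kPart (n : ℕ) : PartitionDiagram :=
  ofLabels (u := n + 2) (l := n + 2)
    (fun x => if (Sum.elim Fin.val Fin.val x) = 0 ∨ (Sum.elim Fin.val Fin.val x) = n + 1
      then 0 else Sum.elim Fin.val Fin.val x)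

/-- The involution `p* ∈ P(l,k)` of `p ∈ P(k,l)`: turn the partition upside down. -/
def invol (p : PartitionDiagram) : PartitionDiagram :=
  ⟨p.lower, p.upper, Setoid.comap Sum.swap p.rel⟩

/-- Auxiliary map splitting the points of a tensor product into the points of the two factors. -/
def splitPoint {a b c d : ℕ} (x : Fin (a + b) ⊕ Fin (c + d)) :
    (Fin a ⊕ Fin c) ⊕ (Fin b ⊕ Fin d) :=
  match x with
  | Sum.inl u =>
    match finSumFinEquiv.symm u with
    | Sum.inl i => Sum.inl (Sum.inl i)
    | Sum.inr i => Sum.inr (Sum.inl i)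
  | Sum.inr v =>
    match finSumFinEquiv.symm v with
    | Sum.inl j => Sum.inl (Sum.inr j)
    | Sum.inr j => Sum.inr (Sum.inr j)

/-- The tensor product (horizontal concatenation) `p ⊗ q` of two partitions. -/
def tensor (p q : PartitionDiagram) : PartitionDiagram :=
  ⟨p.upper + q.upper, p.lower + q.lower,
    Setoid.ker fun x =>
      Sum.map (Quotient.mk p.rel) (Quotient.mk q.rel) (splitPoint x)⟩

section Composition

variable (p q : PartitionDiagram) (h : p.lower = q.upper)

/-- Inclusion of the points of `p` into the three-row diagram used for composition. -/
def iotaP : Fin p.upper ⊕ Fin p.lower → Fin p.upper ⊕ (Fin p.lower ⊕ Fin q.lower) :=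
  Sum.map id Sum.inl

/-- Inclusion of the points of `q` into the three-row diagram used for composition,
identifying the upper points of `q` with the lower points of `p`. -/
def iotaQ : Fin q.upper ⊕ Fin q.lower → Fin p.upper ⊕ (Fin p.lower ⊕ Fin q.lower) :=
  fun x => Sum.inr (Sum.map (Fin.cast h.symm) id x)

/-- The generating relation on the three-row diagram used for composition. -/
def compRel : Fin p.upper ⊕ (Fin p.lower ⊕ Fin q.lower) →
    Fin p.upper ⊕ (Fin p.lower ⊕ Fin q.lower) → Prop :=
  fun x y =>
    (∃ a b, p.rel.r a b ∧ x = iotaP p q a ∧ y = iotaP p q b) ∨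
    (∃ a b, q.rel.r a b ∧ x = iotaQ p q h a ∧ y = iotaQ p q h b)

/-- The composition (vertical concatenation) `qp ∈ P(k,m)` of `p ∈ P(k,l)` and `q ∈ P(l,m)`:
identify the lower points of `p` with the upper points of `q`, take the join of the block
structures and restrict to the upper points of `p` and the lower points of `q`. -/
def comp : PartitionDiagram :=
  ⟨p.upper, q.lower,
    Setoid.comap (Sum.map id Sum.inr) (Relation.EqvGen.setoid (compRel p q h))⟩

end Composition

/-- Rotation of the leftmost upper point to the leftmost lower position. -/
def rotLU (p : PartitionDiagram) (h : 0 < p.upper) : PartitionDiagram :=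
  ⟨p.upper - 1, p.lower + 1,
    Setoid.comap (fun x => match x with
      | Sum.inl j => Sum.inl (⟨(j : ℕ) + 1, by have := j.isLt; omega⟩ : Fin p.upper)
      | Sum.inr j => if hj : (j : ℕ) = 0 then Sum.inl (⟨0, h⟩ : Fin p.upper)
          else Sum.inr (⟨(j : ℕ) - 1, by have := j.isLt; omega⟩ : Fin p.lower)) p.rel⟩

/-- Rotation of the leftmost lower point to the leftmost upper position. -/
def rotLD (p : PartitionDiagram) (h : 0 < p.lower) : PartitionDiagram :=
  ⟨p.upper + 1, p.lower - 1,
    Setoid.comap (fun x => match x with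
      | Sum.inl j => if hj : (j : ℕ) = 0 then Sum.inr (⟨0, h⟩ : Fin p.lower)
          else Sum.inl (⟨(j : ℕ) - 1, by have := j.isLt; omega⟩ : Fin p.upper)
      | Sum.inr j => Sum.inr (⟨(j : ℕ) + 1, by have := j.isLt; omega⟩ : Fin p.lower)) p.rel⟩

/-- Rotation of the rightmost upper point to the rightmost lower position. -/
def rotRU (p : PartitionDiagram) (h : 0 < p.upper) : PartitionDiagram :=
  ⟨p.upper - 1, p.lower + 1,
    Setoid.comap (fun x => match x with
      | Sum.inl j => Sum.inl (⟨(j : ℕ), by have := j.isLt; omega⟩ : Fin p.upper)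
      | Sum.inr j => if hj : (j : ℕ) < p.lower then Sum.inr (⟨(j : ℕ), hj⟩ : Fin p.lower)
          else Sum.inl (⟨p.upper - 1, by omega⟩ : Fin p.upper)) p.rel⟩

/-- Rotation of the rightmost lower point to the rightmost upper position. -/
def rotRD (p : PartitionDiagram) (h : 0 < p.lower) : PartitionDiagram :=
  ⟨p.upper + 1, p.lower - 1,
    Setoid.comap (fun x => match x with
      | Sum.inl j => if hj : (j : ℕ) < p.upper then Sum.inl (⟨(j : ℕ), hj⟩ : Fin p.upper)
          else Sum.inr (⟨p.lower - 1, by omega⟩ : Fin p.lower)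
      | Sum.inr j => Sum.inr (⟨(j : ℕ), by have := j.isLt; omega⟩ : Fin p.lower)) p.rel⟩

/-- The partition obtained from `p` by merging the block of the point `a` and the block of
the point `b` into a single block, leaving all other blocks unchanged. -/
noncomputable def mergeBlocks (p : PartitionDiagram)
    (a b : Fin p.upper ⊕ Fin p.lower) : PartitionDiagram :=
  ⟨p.upper, p.lower,
    Setoid.ker fun x =>
      if p.rel.r x a ∨ p.rel.r x b then (none : Option (Quotient p.rel))
      else some (Quotient.mk p.rel x)⟩

end PartitionDiagram

open PartitionDiagram

/-- A set of partitions is a category of partitions if it contains the identity partition and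
the pair partition and is closed under tensor products, composition, involution and the four
rotation operations. -/
structure IsPartitionCategory (M : Set PartitionDiagram) : Prop where
  id_mem : idPartition ∈ M
  pair_mem : pairPartition ∈ M
  tensor_mem : ∀ p ∈ M, ∀ q ∈ M, tensor p q ∈ M
  comp_mem : ∀ p ∈ M, ∀ q ∈ M, ∀ h : p.lower = q.upper, comp p q h ∈ M
  invol_mem : ∀ p ∈ M, invol p ∈ M
  rotLU_mem : ∀ p ∈ M, ∀ h : 0 < p.upper, rotLU p h ∈ M
  rotLD_mem : ∀ p ∈ M, ∀ h : 0 < p.lower, rotLD p h ∈ M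
  rotRU_mem : ∀ p ∈ M, ∀ h : 0 < p.upper, rotRU p h ∈ M
  rotRD_mem : ∀ p ∈ M, ∀ h : 0 < p.lower, rotRD p h ∈ M

/-- A category of partitions is group-theoretical if it contains the pair positioner
partition `▷`. -/
def IsGroupTheoreticalCategory (M : Set PartitionDiagram) : Prop :=
  IsPartitionCategory M ∧ pairPositioner ∈ M

/-- The smallest category of partitions containing a given set of partitions. -/
def generatedCategory (S : Set PartitionDiagram) : Set PartitionDiagram :=
  ⋂₀ { M | IsPartitionCategory M ∧ S ⊆ M }

/-- The group `Z_2^{*∞}`: the free product of countably many copies of the cyclic group of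
order two. -/
abbrev FreeZ2 := Monoid.CoprodI (fun _ : ℕ => Multiplicative (ZMod 2))

/-- The free generators `a_1, a_2, …` of `Z_2^{*∞}`, each of order two. -/
def gen (n : ℕ) : FreeZ2 :=
  Monoid.CoprodI.of (i := n) (Multiplicative.ofAdd (1 : ZMod 2))

/-- A labelling of a partition assigns (indices of) pairwise distinct generators of
`Z_2^{*∞}` to the blocks: two points receive the same label iff they lie in the same block. -/
def IsLabelling (p : PartitionDiagram) (lab : Fin p.upper ⊕ Fin p.lower → ℕ) : Prop :=
  ∀ x y, lab x = lab y ↔ p.rel.r x y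

/-- The word `w(p,l) ∈ Z_2^{*∞}` of a labelled partition: after rotating all upper points to
the right-hand end of the lower row, read off the generators assigned to the points from left
to right, i.e. read the lower points from left to right and then the upper points from right
to left. -/
def wordOf (p : PartitionDiagram) (lab : Fin p.upper ⊕ Fin p.lower → ℕ) : FreeZ2 :=
  ((List.ofFn fun j : Fin p.lower => gen (lab (Sum.inr j))) ++
    (List.ofFn fun i : Fin p.upper => gen (lab (Sum.inl i))).reverse).prod

/-- `F(C) ⊆ Z_2^{*∞}` is the set of all `w(p,l)` where `p ∈ C` and `l` is a labelling. -/
def Fmap (M : Set PartitionDiagram) : Set FreeZ2 :=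
  { g | ∃ p ∈ M, ∃ lab, IsLabelling p lab ∧ wordOf p lab = g }

/-- The set of partitions admitting a labelling whose word lies in `H`. -/
def catOf (H : Set FreeZ2) : Set PartitionDiagram :=
  { p | ∃ lab, IsLabelling p lab ∧ wordOf p lab ∈ H }

/-- The endomorphism of `Z_2^{*∞}` identifying letters according to `f`, i.e. sending
`a_k` to `a_{f k}` for every `k`. -/
def identifyLetters (f : ℕ → ℕ) : Monoid.End FreeZ2 :=
  Monoid.CoprodI.lift fun i =>
    (Monoid.CoprodI.of (M := fun _ : ℕ => Multiplicative (ZMod 2)) (i := f i))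

/-- The strong symmetric semigroup `sS_∞`: the subsemigroup of `End(Z_2^{*∞})` generated by
the finite identifications of letters. -/
def strongSymmetricSemigroup : Subsemigroup (Monoid.End FreeZ2) :=
  Subsemigroup.closure
    { φ | ∃ f : ℕ → ℕ, (∃ n : ℕ, ∀ k, n ≤ k → f k = k) ∧ φ = identifyLetters f }

/-- A subset of `Z_2^{*∞}` is `sS_∞`-invariant if it is preserved by every element of the
strong symmetric semigroup. -/
def IsSSInvariant (H : Set FreeZ2) : Prop :=
  ∀ φ ∈ strongSymmetricSemigroup, ∀ g ∈ H, φ g ∈ H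

/-- A partition is in single leg form if it has no upper points and no two consecutive
points belong to the same block. -/
def IsSingleLeg (p : PartitionDiagram) : Prop :=
  p.upper = 0 ∧
    ∀ i j : Fin p.lower, (j : ℕ) = (i : ℕ) + 1 → ¬ p.rel.r (Sum.inr i) (Sum.inr j)

/-- `C_sl`: the set of all partitions in `C` with no upper points in single leg form. -/
def slSet (M : Set PartitionDiagram) : Set PartitionDiagram :=
  { p ∈ M | IsSingleLeg p }

/-- The partition with no upper points determined by a word (a list of letters): two points
lie in the same block iff the corresponding letters coincide. -/
def wordPartition (w : List ℕ) : PartitionDiagram :=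
  ofLabels (u := 0) (l := w.length) (Sum.elim (fun i => (i : ℕ)) fun j => w.get j)

/-- The canonical letter of the block of a lower point: the least index of a point in its
block. -/
noncomputable def blockLabel (p : PartitionDiagram) (j : Fin p.lower) : ℕ :=
  sInf { i : ℕ | ∃ h : i < p.lower, p.rel.r (Sum.inr ⟨i, h⟩) (Sum.inr j) }

/-- The canonical word of a partition with no upper points. -/
noncomputable def canonWord (p : PartitionDiagram) : List ℕ :=
  List.ofFn fun j : Fin p.lower => blockLabel p j

/-- Full reduction of a word over an alphabet of involutions: repeatedly delete adjacent
equal pairs of letters.  This computes the result of iterating the operation replacing every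
exponent in the run-decomposition of the word by its parity. -/
def reduceWord (w : List ℕ) : List ℕ :=
  w.foldr (fun x acc => match acc with
    | [] => [x]
    | y :: rest => if x = y then rest else x :: y :: rest) []

/-- The single leg version of a partition with no upper points: the unique partition in
single leg form obtained by iteratively replacing every exponent in its run-decomposition by
its parity. -/
noncomputable def singleLegVersion (p : PartitionDiagram) : PartitionDiagram :=
  wordPartition (reduceWord (canonWord p))

/-- Some partition in `M` has a labelling whose upper row reads `u` and whose lower row reads
`v` (both from left to right). -/
def HasLabelledWords (M : Set PartitionDiagram) (u v : List ℕ) : Prop :=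
  ∃ p ∈ M, ∃ lab, IsLabelling p lab ∧
    u = List.ofFn (fun i : Fin p.upper => lab (Sum.inl i)) ∧
    v = List.ofFn (fun j : Fin p.lower => lab (Sum.inr j))

namespace HasLabelledWords

variable {M : Set PartitionDiagram} {u v : List ℕ} {x : ℕ}

lemma rotLU (hM : IsPartitionCategory M) (h : HasLabelledWords M (x :: u) v) :
    HasLabelledWords M u (x :: v) := by
  obtain ⟨p, hp, lab, hl, hu, rfl⟩ := h
  have hpos : 0 < p.upper := by
    have := congrArg List.length hu
    simp at this
    omega
  refine ⟨_, hM.rotLU_mem p hp hpos, _, fun a b => hl _ _, ?_, ?_⟩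
  · apply List.ext_getElem?
    intro i
    have := congrArg (fun l : List ℕ => l[i + 1]?) hu
    simp only [List.getElem?_cons_succ, List.getElem?_ofFn] at this ⊢
    rw [this]
    simp only [PartitionDiagram.rotLU]
    grind
  · apply List.ext_getElem?
    intro i
    have := congrArg (fun l : List ℕ => l[0]?) hu
    simp only [List.getElem?_ofFn, List.getElem?_cons] at this ⊢
    simp only [PartitionDiagram.rotLU]
    obtain _ | i := i <;> grind

lemma rotLD (hM : IsPartitionCategory M) (h : HasLabelledWords M u (x :: v)) :
    HasLabelledWords M (x :: u) v := by
  obtain ⟨p, hp, lab, hl, rfl, hv⟩ := h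
  have hpos : 0 < p.lower := by
    have := congrArg List.length hv
    simp at this
    omega
  refine ⟨_, hM.rotLD_mem p hp hpos, _, fun a b => hl _ _, ?_, ?_⟩
  · apply List.ext_getElem?
    intro i
    have := congrArg (fun l : List ℕ => l[0]?) hv
    simp only [List.getElem?_ofFn, List.getElem?_cons] at this ⊢
    simp only [PartitionDiagram.rotLD]
    obtain _ | i := i <;> grind
  · apply List.ext_getElem?
    intro i
    have := congrArg (fun l : List ℕ => l[i + 1]?) hv
    simp only [List.getElem?_cons_succ, List.getElem?_ofFn] at this ⊢
    rw [this]
    simp only [PartitionDiagram.rotLD]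
    grind

lemma rotRU (hM : IsPartitionCategory M) (h : HasLabelledWords M (u ++ [x]) v) :
    HasLabelledWords M u (v ++ [x]) := by
  obtain ⟨p, hp, lab, hl, hu, rfl⟩ := h
  have hlen : u.length + 1 = p.upper := by simpa using congrArg List.length hu
  refine ⟨_, hM.rotRU_mem p hp (by omega), _, fun a b => hl _ _, ?_, ?_⟩
  · apply List.ext_getElem?
    intro i
    have := congrArg (fun l : List ℕ => l[i]?) hu
    simp only [List.getElem?_append, List.getElem?_ofFn] at this ⊢
    simp only [PartitionDiagram.rotRU]
    grind
  · apply List.ext_getElem?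
    intro i
    have := congrArg (fun l : List ℕ => l[p.upper - 1]?) hu
    simp only [List.getElem?_append, List.getElem?_ofFn] at this ⊢
    simp only [PartitionDiagram.rotRU]
    grind

lemma rotRD (hM : IsPartitionCategory M) (h : HasLabelledWords M u (v ++ [x])) :
    HasLabelledWords M (u ++ [x]) v := by
  obtain ⟨p, hp, lab, hl, rfl, hv⟩ := h
  have hlen : v.length + 1 = p.lower := by simpa using congrArg List.length hv
  refine ⟨_, hM.rotRD_mem p hp (by omega), _, fun a b => hl _ _, ?_, ?_⟩
  · apply List.ext_getElem?
    intro i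
    have := congrArg (fun l : List ℕ => l[p.lower - 1]?) hv
    simp only [List.getElem?_append, List.getElem?_ofFn] at this ⊢
    simp only [PartitionDiagram.rotRD]
    grind
  · apply List.ext_getElem?
    intro i
    have := congrArg (fun l : List ℕ => l[i]?) hv
    simp only [List.getElem?_append, List.getElem?_ofFn] at this ⊢
    simp only [PartitionDiagram.rotRD]
    grind

lemma rotLU_append (hM : IsPartitionCategory M) (w : List ℕ)
    (h : HasLabelledWords M (w.reverse ++ u) v) : HasLabelledWords M u (w ++ v) := by
  induction w generalizing u with
  | nil => simpa using h
  | cons a w ih => exact rotLU hM (ih (by simpa using h))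

lemma rotLD_append (hM : IsPartitionCategory M) (w : List ℕ)
    (h : HasLabelledWords M u (w ++ v)) : HasLabelledWords M (w.reverse ++ u) v := by
  induction w generalizing u with
  | nil => simpa using h
  | cons a w ih => simpa using ih (rotLD hM h)

lemma rotRU_append (hM : IsPartitionCategory M) (w : List ℕ)
    (h : HasLabelledWords M (u ++ w.reverse) v) : HasLabelledWords M u (v ++ w) := by
  induction w generalizing v with
  | nil => simpa using h
  | cons a w ih => simpa using ih (rotRU hM (by simpa using h))

lemma rotRD_append (hM : IsPartitionCategory M) (w : List ℕ)
    (h : HasLabelledWords M u (v ++ w)) : HasLabelledWords M (u ++ w.reverse) v := by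
  induction w generalizing v with
  | nil => simpa using h
  | cons a w ih => simpa using rotRD hM (ih (v := v ++ [a]) (by simpa using h))

/-- Capping two equal lower letters by the pair partition removes them. -/
lemma cap (hM : IsPartitionCategory M) (h : HasLabelledWords M u [x, x]) :
    HasLabelledWords M u [] := by
  obtain ⟨p, hp, lab, hl, rfl, hv⟩ := h
  have hlen : p.lower = 2 := by simpa using (congrArg List.length hv).symm
  have hx (j : Fin p.lower) : lab (Sum.inr j) = x := by
    have : lab (Sum.inr j) ∈ [x, x] := hv ▸ List.mem_ofFn.2 ⟨j, rfl⟩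
    simpa using this
  have hq := hM.invol_mem _ hM.pair_mem
  let g : Fin p.upper ⊕ (Fin p.lower ⊕ Fin (invol pairPartition).lower) → ℕ :=
    Sum.elim (fun i => lab (Sum.inl i)) fun _ => x
  refine ⟨comp p (invol pairPartition) hlen, hM.comp_mem p hp _ hq hlen,
    fun y => g (Sum.map id Sum.inr y), fun y z => ⟨fun hyz => ?_, fun hyz => ?_⟩, rfl, rfl⟩
  · obtain y | y := y
    · obtain z | z := z
      · exact Relation.EqvGen.rel _ _ (Or.inl ⟨Sum.inl y, Sum.inl z, (hl _ _).1 hyz, rfl, rfl⟩)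
      · exact z.elim0
    · exact y.elim0
  · suffices key : ∀ a b, Relation.EqvGen (compRel p (invol pairPartition) hlen) a b → g a = g b
      from key _ _ hyz
    intro a b hab
    induction hab with
    | rel a b hab =>
      obtain ⟨a, b, hab, rfl, rfl⟩ | ⟨a, b, -, rfl, rfl⟩ := hab
      · have hg (c) : g (iotaP p (invol pairPartition) c) = lab c := by
          obtain c | c := c
          · rfl
          · exact (hx c).symm
        rw [hg, hg]
        exact (hl _ _).2 hab
      · rfl
    | refl => rfl
    | symm _ _ _ ih => exact ih.symm
    | trans _ _ _ _ _ ih₁ ih₂ => exact ih₁.trans ih₂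

lemma cancel (hM : IsPartitionCategory M) (h : HasLabelledWords M [] (u ++ x :: x :: v)) :
    HasLabelledWords M [] (u ++ v) := by
  have h₁ : HasLabelledWords M u.reverse (x :: x :: v) := by simpa using rotLD_append hM u h
  have h₂ := cap hM (rotRD_append (v := [x, x]) hM v h₁)
  have h₃ : HasLabelledWords M u.reverse v := by simpa using rotRU_append hM v h₂
  exact rotLU_append hM u (by simpa using h₃)

end HasLabelledWords

lemma gen_mul_self (n : ℕ) : gen n * gen n = 1 := by
  rw [gen, ← map_mul, ← ofAdd_add, CharTwo.add_self_eq_zero, ofAdd_zero, map_one]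

/-- A word whose partition lies in a category of partitions reduces, without changing the
group element it represents, to such a word without equal neighbouring letters. -/
lemma HasLabelledWords.exists_isChain {M : Set PartitionDiagram} (hM : IsPartitionCategory M)
    (w : List ℕ) (h : HasLabelledWords M [] w) :
    ∃ w', HasLabelledWords M [] w' ∧ w'.IsChain (· ≠ ·) ∧
      (w'.map gen).prod = (w.map gen).prod := by
  by_cases hw : w.IsChain (· ≠ ·)
  · exact ⟨w, h, hw, rfl⟩
  · obtain ⟨u, x, v, rfl⟩ : ∃ u x v, w = u ++ x :: x :: v := by
      simp only [List.isChain_iff_forall_rel_of_append_cons_cons, not_forall, not_not] at hw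
      obtain ⟨x, y, u, v, rfl, rfl⟩ := hw
      exact ⟨_, _, _, rfl⟩
    obtain ⟨w', hw', hc, hprod⟩ := exists_isChain hM (u ++ v) (cancel hM h)
    refine ⟨w', hw', hc, hprod.trans ?_⟩
    simp [← mul_assoc (gen x), gen_mul_self]
termination_by w.length
decreasing_by subst_vars; simp

/-- For every group-theoretical category of partitions `C`, one has
`F(C) = F(C_sl)`: every element of `F(C)` arises from a partition in `C` in single leg form
with no upper points. -/
theorem Fmap_eq_Fmap_slSet (M : Set PartitionDiagram)
    (hM : IsGroupTheoreticalCategory M) :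
    Fmap M = Fmap (slSet M) := by
  have hcat := hM.1
  refine Set.Subset.antisymm ?_ fun g ⟨p, hp, hg⟩ => ⟨p, hp.1, hg⟩
  rintro g ⟨p, hp, lab, hl, rfl⟩
  have hdown : HasLabelledWords M []
      (List.ofFn (fun j : Fin p.lower => lab (Sum.inr j)) ++
        (List.ofFn fun i : Fin p.upper => lab (Sum.inl i)).reverse) :=
    HasLabelledWords.rotRU_append hcat _ (by simpa using ⟨p, hp, lab, hl, rfl, rfl⟩)
  obtain ⟨w, ⟨q, hq, lab', hl', hupper, rfl⟩, hchain, hprod⟩ := hdown.exists_isChain hcat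
  have hq0 : q.upper = 0 := by simpa using (congrArg List.length hupper).symm
  refine ⟨q, ⟨hq, hq0, fun i j hij hr => ?_⟩, lab', hl', ?_⟩
  · rw [List.isChain_iff_getElem] at hchain
    have hi := hchain i (by simp; omega)
    have hj : (⟨(i : ℕ) + 1, by omega⟩ : Fin q.lower) = j := Fin.ext hij.symm
    exact hi (by simpa [hj] using (hl' _ _).2 hr)
  · have hnil : (List.ofFn fun i : Fin q.upper => gen (lab' (Sum.inl i))) = [] := by
      simp [hq0]
    simpa [wordOf, hnil, List.map_ofFn, Function.comp_def] using hprod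
end

section
/- For every group-theoretical category of partitions C, one has C_{F(C)} = C, i.e. a partition p belongs to C if and only if there exists a labelling l with w(p,l) ∈ F(C). -/
open Classical

open PartitionDiagram

namespace PartitionDiagram

/-- The labelling of an upper and a lower row of points by the entries of two lists. -/
def rowLabel (u l : List ℕ) {a b : ℕ} : Fin a ⊕ Fin b → ℕ :=
  Sum.elim (fun i => u.getD i 0) fun j => l.getD j 0

/-- The lists `u` and `l` label the upper and the lower points of `p` by blocks. -/
def Represents (p : PartitionDiagram) (u l : List ℕ) : Prop :=
  p.upper = u.length ∧ p.lower = l.length ∧ IsLabelling p (rowLabel u l)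

theorem _root_.IsLabelling.represents {p : PartitionDiagram} {lab : Fin p.upper ⊕ Fin p.lower → ℕ}
    (h : IsLabelling p lab) :
    Represents p (List.ofFn fun i => lab (Sum.inl i)) (List.ofFn fun j => lab (Sum.inr j)) := by
  refine ⟨by simp, by simp, ?_⟩
  convert h
  funext x
  rcases x with i | j <;> simp [rowLabel]

theorem Represents.unique {p q : PartitionDiagram} {u l : List ℕ}
    (hp : Represents p u l) (hq : Represents q u l) : p = q := by
  obtain ⟨a, b, r⟩ := p
  obtain ⟨c, d, s⟩ := q
  obtain ⟨h₁, h₂, h₃⟩ := hp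
  obtain ⟨h₄, h₅, h₆⟩ := hq
  simp only at h₁ h₂ h₄ h₅
  subst h₁ h₂ h₄ h₅
  congr 1
  ext x y
  exact (h₃ x y).symm.trans (h₆ x y)

theorem exists_isLabelling (p : PartitionDiagram) : ∃ lab, IsLabelling p lab := by
  obtain ⟨e⟩ : Nonempty (Quotient p.rel ↪ ℕ) :=
    ⟨(Finite.equivFin (Quotient p.rel)).toEmbedding.trans Fin.valEmbedding⟩
  exact ⟨fun x => e (Quotient.mk p.rel x), fun x y =>
    e.injective.eq_iff.trans (Quotient.eq (r := p.rel))⟩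

theorem rowLabel_mem {u l : List ℕ} {a b : ℕ} (ha : a = u.length) (hb : b = l.length)
    (x : Fin a ⊕ Fin b) : rowLabel u l x ∈ u ++ l := by
  subst ha hb
  rcases x with i | j <;> simp [rowLabel]

theorem Represents.rotLD {p : PartitionDiagram} {u l : List ℕ} {x : ℕ}
    (hp : Represents p u (x :: l)) :
    ∃ h : 0 < p.lower, Represents (p.rotLD h) (x :: u) l := by
  obtain ⟨h₁, h₂, h₃⟩ := hp
  refine ⟨by simp [h₂], by simp [PartitionDiagram.rotLD, h₁], by simp [PartitionDiagram.rotLD, h₂],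
    fun y z => ?_⟩
  refine Iff.trans (Eq.congr ?_ ?_) (h₃ _ _)
  · rcases y with ⟨_ | i, hi⟩ | ⟨j, hj⟩ <;> simp [rowLabel]
  · rcases z with ⟨_ | i, hi⟩ | ⟨j, hj⟩ <;> simp [rowLabel]

theorem Represents.rotRU {p : PartitionDiagram} {u l : List ℕ} {x : ℕ}
    (hp : Represents p (u ++ [x]) l) :
    ∃ h : 0 < p.upper, Represents (p.rotRU h) u (l ++ [x]) := by
  obtain ⟨h₁, h₂, h₃⟩ := hp
  have hu : p.upper = u.length + 1 := by simp [h₁]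
  refine ⟨by omega, by simp [PartitionDiagram.rotRU, h₁], by simp [PartitionDiagram.rotRU, h₂],
    fun y z => ?_⟩
  have key : ∀ (y : Fin (p.upper - 1) ⊕ Fin (p.lower + 1)), rowLabel u (l ++ [x]) y =
      rowLabel (u ++ [x]) l (match y with
      | Sum.inl j => Sum.inl (⟨(j : ℕ), by have := j.isLt; omega⟩ : Fin p.upper)
      | Sum.inr j => if hj : (j : ℕ) < p.lower then Sum.inr (⟨(j : ℕ), hj⟩ : Fin p.lower)
          else Sum.inl (⟨p.upper - 1, by omega⟩ : Fin p.upper)) := by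
    rintro (⟨i, hi⟩ | ⟨j, hj⟩)
    · have : i < u.length := by omega
      simp [rowLabel, List.getElem?_append_left this]
    · rcases Nat.lt_succ_iff_lt_or_eq.mp hj with h | h
      · have : j < l.length := by omega
        simp [rowLabel, h, List.getElem?_append_left this]
      · have h' : j = l.length := by omega
        simp [rowLabel, h', h₂, hu]
  exact Iff.trans (Eq.congr (key y) (key z)) (h₃ _ _)

theorem Represents.rotRD {p : PartitionDiagram} {u l : List ℕ} {x : ℕ}
    (hp : Represents p u (l ++ [x])) :
    ∃ h : 0 < p.lower, Represents (p.rotRD h) (u ++ [x]) l := by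
  obtain ⟨h₁, h₂, h₃⟩ := hp
  have hl : p.lower = l.length + 1 := by simp [h₂]
  refine ⟨by omega, by simp [PartitionDiagram.rotRD, h₁], by simp [PartitionDiagram.rotRD, h₂],
    fun y z => ?_⟩
  have key : ∀ (y : Fin (p.upper + 1) ⊕ Fin (p.lower - 1)), rowLabel (u ++ [x]) l y =
      rowLabel u (l ++ [x]) (match y with
      | Sum.inl j => if hj : (j : ℕ) < p.upper then Sum.inl (⟨(j : ℕ), hj⟩ : Fin p.upper)
          else Sum.inr (⟨p.lower - 1, by omega⟩ : Fin p.lower)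
      | Sum.inr j => Sum.inr (⟨(j : ℕ), by have := j.isLt; omega⟩ : Fin p.lower)) := by
    rintro (⟨j, hj⟩ | ⟨i, hi⟩)
    · rcases Nat.lt_succ_iff_lt_or_eq.mp hj with h | h
      · have : j < u.length := by omega
        simp [rowLabel, h, List.getElem?_append_left this]
      · have h' : j = u.length := by omega
        simp [rowLabel, h', h₁, hl]
    · have : i < l.length := by omega
      simp [rowLabel, List.getElem?_append_left this]
  exact Iff.trans (Eq.congr (key y) (key z)) (h₃ _ _)

theorem rowLabel_append_eq_elim_splitPoint {u l u' l' : List ℕ} {a b c d : ℕ}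
    (ha : a = u.length) (hc : c = l.length) (x : Fin (a + b) ⊕ Fin (c + d)) :
    rowLabel (u ++ u') (l ++ l') x =
      Sum.elim (rowLabel u l) (rowLabel u' l') (splitPoint x) := by
  subst ha hc
  rcases x with i | j
  · induction i using Fin.addCases <;> simp [rowLabel, splitPoint, List.getElem?_append]
  · induction j using Fin.addCases <;> simp [rowLabel, splitPoint, List.getElem?_append]

theorem Represents.tensor {p q : PartitionDiagram} {u l u' l' : List ℕ}
    (hp : Represents p u l) (hq : Represents q u' l') (hd : List.Disjoint (u ++ l) (u' ++ l')) :
    Represents (p.tensor q) (u ++ u') (l ++ l') := by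
  obtain ⟨h₁, h₂, h₃⟩ := hp
  obtain ⟨h₄, h₅, h₆⟩ := hq
  refine ⟨by simp [PartitionDiagram.tensor, h₁, h₄], by simp [PartitionDiagram.tensor, h₂, h₅],
    fun x y => ?_⟩
  have key : ∀ x' y' : (Fin p.upper ⊕ Fin p.lower) ⊕ (Fin q.upper ⊕ Fin q.lower),
      Sum.elim (rowLabel u l) (rowLabel u' l') x' = Sum.elim (rowLabel u l) (rowLabel u' l') y' ↔
        Sum.map (Quotient.mk p.rel) (Quotient.mk q.rel) x' =
          Sum.map (Quotient.mk p.rel) (Quotient.mk q.rel) y' := by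
    rintro (x | x) (y | y)
    · simpa [Quotient.eq] using h₃ x y
    · simp only [Sum.elim_inl, Sum.elim_inr, Sum.map_inl, Sum.map_inr, reduceCtorEq, iff_false]
      intro h
      exact hd (rowLabel_mem h₁ h₂ x) (h ▸ rowLabel_mem h₄ h₅ y)
    · simp only [Sum.elim_inl, Sum.elim_inr, Sum.map_inl, Sum.map_inr, reduceCtorEq, iff_false]
      intro h
      exact hd (rowLabel_mem h₁ h₂ y) (h ▸ rowLabel_mem h₄ h₅ x)
    · simpa [Quotient.eq] using h₆ x y
  exact Iff.trans (Eq.congr (rowLabel_append_eq_elim_splitPoint h₁ h₂ x)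
    (rowLabel_append_eq_elim_splitPoint h₁ h₂ y)) (key _ _)

/-- Composing a partition labelled by the word `u.map f` with a partition labelled by `u` and `l`
all of whose lower points are connected to upper points. -/
theorem Represents.comp {p q : PartitionDiagram} {u l : List ℕ} {f : ℕ → ℕ}
    (hp : Represents p [] (u.map f)) (hq : Represents q u l) (hl : l ⊆ u) :
    ∃ h : p.lower = q.upper, Represents (p.comp q h) [] (l.map f) := by
  obtain ⟨h₁, h₂, h₃⟩ := hp
  obtain ⟨h₄, h₅, h₆⟩ := hq
  have h : p.lower = q.upper := by simp [h₂, h₄]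
  have hempty : IsEmpty (Fin p.upper) := by rw [h₁]; exact Fin.isEmpty
  refine ⟨h, h₁, by simp [PartitionDiagram.comp, h₅], ?_⟩
  rintro (x | x)
  · exact hempty.elim x
  rintro (y | y)
  · exact hempty.elim y
  change _ ↔ Relation.EqvGen (compRel p q h) (Sum.inr (Sum.inr x)) (Sum.inr (Sum.inr y))
  constructor
  · intro hxy
    have hmid : ∀ z : Fin q.lower, ∃ i : Fin q.upper,
        q.rel.r (Sum.inl i) (Sum.inr z) ∧ (u.map f).getD i 0 = (l.map f).getD z 0 := by
      intro z
      have hz : (z : ℕ) < l.length := h₅ ▸ z.isLt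
      obtain ⟨i, hi, e⟩ := List.mem_iff_getElem.mp (hl (List.getElem_mem hz))
      refine ⟨⟨i, h₄ ▸ hi⟩, (h₆ _ _).mp ?_, ?_⟩
      · simp [rowLabel, hi, hz, e]
      · simp [hi, hz, e]
    obtain ⟨i, hi, ei⟩ := hmid x
    obtain ⟨j, hj, ej⟩ := hmid y
    refine .trans _ (Sum.inr (Sum.inl (Fin.cast h.symm i))) _
      (.rel _ _ (Or.inr ⟨_, _, q.rel.symm hi, rfl, rfl⟩)) ?_
    refine .trans _ (Sum.inr (Sum.inl (Fin.cast h.symm j))) _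
      (.rel _ _ (Or.inl ⟨Sum.inr (Fin.cast h.symm i), Sum.inr (Fin.cast h.symm j),
        (h₃ _ _).mp ?_, rfl, rfl⟩)) (.rel _ _ (Or.inr ⟨_, _, hj, rfl, rfl⟩))
    exact ei.trans (Eq.trans hxy ej.symm)
  · intro hxy
    let lab : Fin p.upper ⊕ (Fin p.lower ⊕ Fin q.lower) → ℕ :=
      Sum.elim (fun _ => 0) (Sum.elim (fun i => (u.map f).getD i 0) fun j => (l.map f).getD j 0)
    have hQ : ∀ a, lab (iotaQ p q h a) = f (rowLabel u l a) := by
      rintro (i | j)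
      · have : (i : ℕ) < u.length := h₄ ▸ i.isLt
        simp [lab, iotaQ, rowLabel, this]
      · have : (j : ℕ) < l.length := h₅ ▸ j.isLt
        simp [lab, iotaQ, rowLabel, this]
    have hP : ∀ a, lab (iotaP p q a) = rowLabel [] (u.map f) a := by
      rintro (i | j)
      · exact hempty.elim i
      · rfl
    have hle : Relation.EqvGen.setoid (compRel p q h) ≤ Setoid.ker lab := by
      refine Setoid.eqvGen_le ?_
      rintro _ _ (⟨a, b, hab, rfl, rfl⟩ | ⟨a, b, hab, rfl, rfl⟩)
      · exact (hP a).trans (((h₃ a b).mpr hab).trans (hP b).symm)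
      · exact (hQ a).trans ((congrArg f ((h₆ a b).mpr hab)).trans (hQ b).symm)
    exact hle hxy

/-- The partition labelled by `u` and `l` belongs to `M`. -/
def LabelMem (M : Set PartitionDiagram) (u l : List ℕ) : Prop :=
  ∃ p ∈ M, Represents p u l

/-- Two words are congruent if exchanging them as subwords preserves membership in `M`. -/
def wordCon (M : Set PartitionDiagram) : Con (FreeMonoid ℕ) where
  r u v := ∀ x y : FreeMonoid ℕ,
    LabelMem M [] (x * u * y).toList ↔ LabelMem M [] (x * v * y).toList
  iseqv := ⟨fun _ _ _ => Iff.rfl, fun h x y => (h x y).symm,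
    fun h h' x y => (h x y).trans (h' x y)⟩
  mul' {u v u' v'} h h' x y := by
    have h₁ := h x (u' * y)
    have h₂ := h' (x * v) y
    simp only [mul_assoc] at h₁ h₂ ⊢
    exact h₁.trans h₂

/-- The class of the one-letter word `n` modulo `wordCon`. -/
def letterClass (M : Set PartitionDiagram) (n : ℕ) : (wordCon M).Quotient :=
  (FreeMonoid.of n : FreeMonoid ℕ)

end PartitionDiagram

namespace IsPartitionCategory

variable {M : Set PartitionDiagram} (hM : IsPartitionCategory M)
include hM

theorem labelMem_append_iff {u l : List ℕ} {x : ℕ} :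
    LabelMem M (u ++ [x]) l ↔ LabelMem M u (l ++ [x]) := by
  constructor
  · rintro ⟨p, hp, h⟩
    obtain ⟨h0, h⟩ := h.rotRU
    exact ⟨_, hM.rotRU_mem p hp h0, h⟩
  · rintro ⟨p, hp, h⟩
    obtain ⟨h0, h⟩ := h.rotRD
    exact ⟨_, hM.rotRD_mem p hp h0, h⟩

theorem labelMem_iff_nil {u l : List ℕ} :
    LabelMem M u l ↔ LabelMem M [] (l ++ u.reverse) := by
  induction u using List.reverseRecOn generalizing l with
  | nil => simp
  | append_singleton u x ih => rw [hM.labelMem_append_iff, ih]; simp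

theorem labelMem_rotate {x y : List ℕ} (h : LabelMem M [] (x ++ y)) : LabelMem M [] (y ++ x) := by
  induction x generalizing y with
  | nil => simpa using h
  | cons a x ih =>
    obtain ⟨p, hp, h⟩ := h
    obtain ⟨h0, h⟩ := h.rotLD
    have := (hM.labelMem_append_iff (u := [])).mp ⟨_, hM.rotLD_mem p hp h0, h⟩
    simpa using ih (y := y ++ [a]) (by simpa using this)

theorem labelMem_tensor {u l u' l' : List ℕ} (h : LabelMem M u l) (h' : LabelMem M u' l')
    (hd : List.Disjoint (u ++ l) (u' ++ l')) : LabelMem M (u ++ u') (l ++ l') := by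
  obtain ⟨p, hp, h⟩ := h
  obtain ⟨q, hq, h'⟩ := h'
  exact ⟨_, hM.tensor_mem p hp q hq, h.tensor h' hd⟩

theorem labelMem_id (a : ℕ) : LabelMem M [a] [a] := by
  refine ⟨_, hM.id_mem, rfl, rfl, fun x y => iff_of_true ?_ rfl⟩
  rcases x with ⟨x, hx⟩ | ⟨x, hx⟩ <;> rcases y with ⟨y, hy⟩ | ⟨y, hy⟩ <;>
    simp [idPartition, ofLabels] at hx hy <;> simp [rowLabel, hx, hy]

theorem labelMem_pair (a : ℕ) : LabelMem M [] [a, a] := by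
  refine ⟨_, hM.pair_mem, rfl, rfl, fun x y => iff_of_true ?_ rfl⟩
  have key : ∀ x : Fin 0 ⊕ Fin 2, rowLabel [] [a, a] x = a := by
    rintro (x | x)
    · exact x.elim0
    · fin_cases x <;> rfl
  exact (key x).trans (key y).symm

theorem labelMem_append_nodup {u l y : List ℕ} (h : LabelMem M u l) (hy : y.Nodup)
    (hd : List.Disjoint (u ++ l) y) : LabelMem M (u ++ y) (l ++ y) := by
  induction y using List.reverseRecOn with
  | nil => simpa using h
  | append_singleton y a ih =>
    rw [List.nodup_append] at hy
    simp only [List.disjoint_append_right] at hd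
    rw [← List.append_assoc, ← List.append_assoc]
    refine hM.labelMem_tensor (ih hy.1 hd.1) (hM.labelMem_id a) ?_
    have ha : a ∉ y := fun h => hy.2.2 a h a (by simp) rfl
    have hd2 := hd.2
    simp only [List.disjoint_singleton, List.mem_append, not_or] at hd2
    intro k hk hk'
    obtain rfl : k = a := by simpa using hk'
    simp [ha, hd2] at hk

/-- A partition all of whose lower points are connected to upper points acts on the initial
segments of words. -/
theorem labelMem_apply {u l y : List ℕ} {f : ℕ → ℕ} (h : LabelMem M u l) (hl : l ⊆ u)
    (hw : LabelMem M [] (u.map f ++ y)) : LabelMem M [] (l.map f ++ y) := by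
  obtain ⟨N, hN⟩ : ∃ N, ∀ k ∈ u, k < N :=
    ⟨u.sum + 1, fun k hk => Nat.lt_succ_of_le (List.single_le_sum (by simp) k hk)⟩
  let z := List.range' N y.length
  let g : ℕ → ℕ := fun k => if k < N then f k else y.getD (k - N) 0
  have hz : z.map g = y := by
    refine List.ext_getElem (by simp [z]) fun i h₁ h₂ => ?_
    simp [z, g, h₂]
  have hu : ∀ v, v ⊆ u → v.map g = v.map f := fun v hv =>
    List.map_congr_left fun k hk => by simp [g, hN k (hv hk)]
  obtain ⟨q, hq, hq'⟩ := hM.labelMem_append_nodup (y := z) h List.nodup_range' (by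
    intro k hk hk'
    have : k ∈ u := by
      rcases List.mem_append.mp hk with h | h
      exacts [h, hl h]
    have := hN k this
    have := (List.mem_range'_1.mp hk').1
    omega)
  obtain ⟨p, hp, hp'⟩ := hw
  rw [← hu u (List.Subset.refl u), ← hz, ← List.map_append] at hp'
  obtain ⟨e, he⟩ := hp'.comp hq' (by
    intro k hk
    rw [List.mem_append] at hk ⊢
    exact hk.imp_left fun h => hl h)
  rw [List.map_append, hz, hu l hl] at he
  exact ⟨_, hM.comp_mem p hp q hq e, he⟩

theorem labelMem_of_pair_append {a : ℕ} {y : List ℕ} (h : LabelMem M [] (a :: a :: y)) :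
    LabelMem M [] y :=
  hM.labelMem_apply (u := [0, 0]) (l := []) (f := fun _ => a)
    (hM.labelMem_iff_nil.mpr (hM.labelMem_pair 0)) (by simp) h

end IsPartitionCategory

namespace IsGroupTheoreticalCategory

variable {M : Set PartitionDiagram} (hM : IsGroupTheoreticalCategory M)
include hM

theorem labelMem_pairPositioner : LabelMem M [0, 0, 1] [1, 0, 0] := by
  refine ⟨_, hM.2, rfl, rfl, fun x y => ?_⟩
  have key : ∀ x : Fin 3 ⊕ Fin 3, rowLabel [0, 0, 1] [1, 0, 0] x =
    (Sum.elim (fun i : Fin 3 => if (i : ℕ) = 2 then 1 else 0)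
      fun j : Fin 3 => if (j : ℕ) = 0 then 1 else 0) x := by
    rintro (x | x) <;> fin_cases x <;> rfl
  exact Eq.congr (key x) (key y)

theorem labelMem_fourBlock : LabelMem M [0] [0, 0, 0] := by
  have h₁ := hM.1.labelMem_rotate (x := [1, 0, 0]) (y := [1, 0, 0])
    (hM.1.labelMem_iff_nil.mp hM.labelMem_pairPositioner)
  have h₂ := hM.1.labelMem_rotate (x := [1]) (y := [0, 0, 1, 0, 0]) h₁
  have h₃ := hM.1.labelMem_apply (f := id) (y := [0, 0, 1]) hM.labelMem_pairPositioner (by simp) h₂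
  have h₄ := hM.1.labelMem_rotate (x := [1, 0, 0, 0, 0]) (y := [1]) h₃
  exact hM.1.labelMem_iff_nil.mpr (hM.1.labelMem_of_pair_append h₄)

theorem labelMem_move {a : ℕ} {x y : List ℕ} (h : LabelMem M [] (a :: a :: (x ++ y))) :
    LabelMem M [] (a :: a :: (y ++ x)) := by
  induction x generalizing y with
  | nil => simpa using h
  | cons b x ih =>
    have := hM.1.labelMem_apply (y := x ++ y) (f := fun k => if k = 0 then a else b)
      hM.labelMem_pairPositioner (by simp) (by simpa using h)
    have := hM.1.labelMem_rotate (x := [b]) (y := a :: a :: (x ++ y)) (by simpa using this)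
    simpa using ih (y := y ++ [b]) (by simpa using this)

theorem labelMem_cons_cons_iff {a : ℕ} {y : List ℕ} :
    LabelMem M [] (a :: a :: y) ↔ LabelMem M [] y := by
  refine ⟨hM.1.labelMem_of_pair_append, fun h => ?_⟩
  by_cases ha : a ∈ y
  · obtain ⟨s, t, rfl⟩ := List.append_of_mem ha
    have := hM.1.labelMem_apply (f := fun _ => a) (y := t ++ s) hM.labelMem_fourBlock
      (by simp) (by simpa using hM.1.labelMem_rotate h)
    exact hM.labelMem_move (x := a :: t) (by simpa using this)
  · refine hM.1.labelMem_rotate (y := [a, a])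
      (hM.1.labelMem_tensor (u := []) (u' := []) h (hM.1.labelMem_pair a) ?_)
    simpa using ha

theorem letterClass_mul_self (n : ℕ) : letterClass M n * letterClass M n = 1 := by
  refine (Con.eq _).mpr fun x y => ?_
  have h₁ : ∀ z : List ℕ, LabelMem M [] (x.toList ++ z ++ y.toList) ↔
      LabelMem M [] (z ++ (y.toList ++ x.toList)) := fun z =>
    ⟨fun h => List.append_assoc z _ _ ▸ hM.1.labelMem_rotate (List.append_assoc _ z _ ▸ h),
      fun h => by simpa using hM.1.labelMem_rotate (x := z ++ y.toList) (by simpa using h)⟩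
  exact (h₁ [n, n]).trans (hM.labelMem_cons_cons_iff.trans (h₁ []).symm)

/-- The homomorphism from `Z_2^{*∞}` sending each generator to its class modulo `wordCon`. -/
def toWordCon : FreeZ2 →* (wordCon M).Quotient :=
  Monoid.CoprodI.lift fun n =>
    { toFun := fun z => letterClass M n ^ (Multiplicative.toAdd z).val
      map_one' := pow_zero _
      map_mul' := fun y z => by
        have h := hM.letterClass_mul_self n
        revert y z
        change ∀ y z : ZMod 2, _ ^ (y + z).val = _ ^ y.val * _ ^ z.val
        intro y z
        rw [ZMod.val_add, ← pow_add]
        exact (pow_eq_pow_mod (y.val + z.val) ((pow_two _).trans h)).symm }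

theorem toWordCon_gen (n : ℕ) : hM.toWordCon (gen n) = letterClass M n := by
  rw [toWordCon, gen, Monoid.CoprodI.lift_of]
  exact pow_one _

theorem toWordCon_prod (w : List ℕ) :
    hM.toWordCon (w.map gen).prod = (FreeMonoid.ofList w : (wordCon M).Quotient) := by
  induction w with
  | nil => exact map_one _
  | cons a w ih => rw [List.map_cons, List.prod_cons, map_mul, ih, toWordCon_gen]; rfl

/-- Membership of a word in `M` depends only on the element of `Z_2^{*∞}` it spells. -/
theorem labelMem_of_prod_eq {v w : List ℕ} (h : (v.map gen).prod = (w.map gen).prod)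
    (hv : LabelMem M [] v) : LabelMem M [] w := by
  have h' := congrArg hM.toWordCon h
  rw [toWordCon_prod, toWordCon_prod] at h'
  simpa using (((Con.eq _).mp h') 1 1).mp (by simpa using hv)

end IsGroupTheoreticalCategory

theorem wordOf_eq_prod_map_gen (p : PartitionDiagram) (lab : Fin p.upper ⊕ Fin p.lower → ℕ) :
    wordOf p lab = (((List.ofFn fun j => lab (Sum.inr j)) ++
      (List.ofFn fun i => lab (Sum.inl i)).reverse).map gen).prod := by
  simp [wordOf, List.map_reverse, List.map_ofFn, Function.comp_def]

/-- For every group-theoretical category of partitions `C`, one has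
`C_{F(C)} = C`: a partition `p` belongs to `C` if and only if there is a labelling `l` with
`w(p,l) ∈ F(C)`. -/
theorem catOf_Fmap_eq (M : Set PartitionDiagram)
    (hM : IsGroupTheoreticalCategory M) :
    catOf (Fmap M) = M := by
  refine Set.Subset.antisymm ?_ fun p hp => ?_
  · rintro p ⟨lab, hlab, q, hq, lab', hlab', heq⟩
    rw [wordOf_eq_prod_map_gen, wordOf_eq_prod_map_gen] at heq
    obtain ⟨r, hr, hr'⟩ := hM.1.labelMem_iff_nil.mpr
      (hM.labelMem_of_prod_eq heq (hM.1.labelMem_iff_nil.mp ⟨q, hq, hlab'.represents⟩))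
    exact hlab.represents.unique hr' ▸ hr
  · obtain ⟨lab, hlab⟩ := exists_isLabelling p
    exact ⟨lab, hlab, p, hp, lab, hlab, rfl⟩
end
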